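/- Fix an integer d ≥ 3 and constants 1 < λ < d-1, and set p = λ/(d-1). There exist constants c > 0 (sufficiently small with respect to λ-1) and C > 1 such that for every ε > 0 there exists n_0 with the following property: for every n ≥ n_0 and every d-regular graph G on n vertices satisfying (P2), with probability at least 1-ε the random subgraph G_p has no connected component whose order lies in the interval [5λ log n/(λ-1)², log^C n]. -/

import Mathlib

open scoped Classical

/-- Number of edges of `G` with both endpoints in `U`. -/
noncomputable def edgesWithin {V : Type*} (G : SimpleGraph V) (U : Set V) : ℕ :=
  {e ∈ G.edgeSet | ∀ v ∈ e, v ∈ U}.ncard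

/-- Number of edges of `G` with exactly one endpoint in `U`. -/
noncomputable def edgesAcross {V : Type*} (G : SimpleGraph V) (U : Set V) : ℕ :=
  {e ∈ G.edgeSet | (∃ a ∈ e, a ∈ U) ∧ (∃ b ∈ e, b ∉ U)}.ncard

/-- `G` is `d`-regular. -/
def isRegular {V : Type*} (G : SimpleGraph V) (d : ℕ) : Prop :=
  ∀ v, (G.neighborSet v).ncard = d

/-- The number of vertices of the connected component of `v` in `H`. -/
noncomputable def compCard {V : Type*} (H : SimpleGraph V) (v : V) : ℕ :=
  {u | H.Reachable v u}.ncard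

/-- The weight of the edge subset `S` under `p`-bond percolation on `G`. -/
noncomputable def percWeight {V : Type*} [Fintype V] (G : SimpleGraph V) (p : ℝ)
    (S : Finset (Sym2 V)) : ℝ :=
  p ^ S.card * (1 - p) ^ (G.edgeFinset.card - S.card)

/-- The probability, under `p`-bond percolation on `G` (each edge retained independently
with probability `p`), that the retained edge set satisfies `Q`. -/
noncomputable def percProb {V : Type*} [Fintype V] (G : SimpleGraph V) (p : ℝ)
    (Q : Finset (Sym2 V) → Prop) : ℝ :=
  ∑ S ∈ G.edgeFinset.powerset, if Q S then percWeight G p S else 0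

/-- The probability, under two independent bond percolations on `G` with probabilities
`p₁` and `p₂`, that the pair of retained edge sets satisfies `Q`. -/
noncomputable def percProb2 {V : Type*} [Fintype V] (G : SimpleGraph V) (p₁ p₂ : ℝ)
    (Q : Finset (Sym2 V) → Finset (Sym2 V) → Prop) : ℝ :=
  ∑ S₁ ∈ G.edgeFinset.powerset, ∑ S₂ ∈ G.edgeFinset.powerset,
    if Q S₁ S₂ then percWeight G p₁ S₁ * percWeight G p₂ S₂ else 0

/-- The vertex set of the connected component of `v` in the graph with edge set `S`. -/
noncomputable def cluster {V : Type*} [Fintype V] (S : Finset (Sym2 V)) (v : V) : Finset V :=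
  {u | (SimpleGraph.fromEdgeSet (S : Set (Sym2 V))).Reachable v u}

/-- The edges of `G` with at least one endpoint in `U`. -/
noncomputable def edgesTouching {V : Type*} [Fintype V] (G : SimpleGraph V) (U : Finset V) :
    Finset (Sym2 V) :=
  {e ∈ G.edgeFinset | ∃ x ∈ e, x ∈ U}

lemma mem_cluster {V : Type*} [Fintype V] {S : Finset (Sym2 V)} {v u : V} :
    u ∈ cluster S v ↔ (SimpleGraph.fromEdgeSet (S : Set (Sym2 V))).Reachable v u := by
  simp [cluster]

lemma self_mem_cluster {V : Type*} [Fintype V] (S : Finset (Sym2 V)) (v : V) :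
    v ∈ cluster S v := mem_cluster.2 (SimpleGraph.Reachable.refl _)

lemma compCard_eq_card_cluster {V : Type*} [Fintype V] (S : Finset (Sym2 V)) (v : V) :
    compCard (SimpleGraph.fromEdgeSet (S : Set (Sym2 V))) v = (cluster S v).card := by
  rw [compCard, ← Set.ncard_coe_finset]
  congr 1
  ext u
  simp [mem_cluster]

lemma mem_cluster_of_mem {V : Type*} [Fintype V] {S : Finset (Sym2 V)} {v a b : V}
    (ha : a ∈ cluster S v) (hab : s(a, b) ∈ S) : b ∈ cluster S v := by
  by_cases h : a = b
  · exact h ▸ ha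
  · rw [mem_cluster] at ha ⊢
    refine ha.trans (SimpleGraph.Adj.reachable ?_)
    rw [SimpleGraph.fromEdgeSet_adj]
    exact ⟨hab, h⟩

/-- A set containing `v` and closed under the edges of `S` contains the cluster of `v`. -/
lemma cluster_subset {V : Type*} [Fintype V] {S : Finset (Sym2 V)} {v : V} {U : Finset V}
    (hv : v ∈ U) (hU : ∀ a ∈ U, ∀ b, s(a, b) ∈ S → b ∈ U) : cluster S v ⊆ U := by
  intro u hu
  rw [mem_cluster, SimpleGraph.reachable_iff_reflTransGen] at hu
  induction hu with
  | refl => exact hv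
  | tail _ hab ih =>
    rw [SimpleGraph.fromEdgeSet_adj] at hab
    exact hU _ ih _ hab.1

lemma cluster_mono {V : Type*} [Fintype V] {S T : Finset (Sym2 V)} (h : S ⊆ T) (v : V) :
    cluster S v ⊆ cluster T v :=
  cluster_subset (self_mem_cluster T v) fun _ ha _ hab => mem_cluster_of_mem ha (h hab)

/-- The event that the cluster of `v` is `U` depends only on the edges touching `U`. -/
lemma cluster_eq_iff_inter {V : Type*} [Fintype V] {G : SimpleGraph V} {S : Finset (Sym2 V)}
    (hS : S ⊆ G.edgeFinset) (v : V) (U : Finset V) :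
    cluster S v = U ↔ cluster (S ∩ edgesTouching G U) v = U := by
  have touch : ∀ {a b}, a ∈ U → s(a, b) ∈ S → s(a, b) ∈ S ∩ edgesTouching G U := by
    intro a b ha hab
    simp only [Finset.mem_inter, edgesTouching, Finset.mem_filter]
    exact ⟨hab, hS hab, a, by simp, ha⟩
  have hsub : cluster (S ∩ edgesTouching G U) v ⊆ cluster S v :=
    cluster_mono Finset.inter_subset_left v
  constructor
  · intro h
    refine Finset.Subset.antisymm (h ▸ hsub) ?_
    nth_rewrite 1 [← h]
    refine cluster_subset (self_mem_cluster _ v) fun a ha b hab => ?_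
    exact mem_cluster_of_mem ha (touch (h ▸ hsub ha) hab)
  · intro h
    refine Finset.Subset.antisymm ?_ (by nth_rewrite 1 [← h]; exact hsub)
    refine cluster_subset (by rw [← h]; exact self_mem_cluster _ v) fun a ha b hab => ?_
    have := mem_cluster_of_mem (by rw [h]; exact ha) (touch ha hab)
    rwa [h] at this

/-- If the cluster of `v` in `A` is `U` and every edge of `A` touches `U`, then every edge of `A`
lies within `U`. -/
lemma card_le_edgesWithin {V : Type*} [Fintype V] {G : SimpleGraph V} {A : Finset (Sym2 V)}
    {v : V} {U : Finset V} (hA : A ⊆ edgesTouching G U) (hU : cluster A v = U) :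
    A.card ≤ edgesWithin G (U : Set V) := by
  rw [edgesWithin, ← Set.ncard_coe_finset]
  refine Set.ncard_le_ncard ?_ (Set.toFinite _)
  intro e he
  have h := hA he
  simp only [edgesTouching, Finset.mem_filter, SimpleGraph.mem_edgeFinset] at h
  obtain ⟨heG, x, hx, hxU⟩ := h
  refine ⟨heG, fun y hy => ?_⟩
  obtain ⟨z, rfl⟩ := hx
  rcases Sym2.mem_iff.1 hy with rfl | rfl
  · exact hxU
  · rw [← hU] at hxU ⊢
    exact mem_cluster_of_mem hxU he

/-- Double counting of the vertex-edge incidences in a regular graph. -/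
lemma mul_card_le_edgesTouching_add {V : Type*} [Fintype V] {G : SimpleGraph V} {d : ℕ}
    (hG : isRegular G d) (U : Finset V) :
    d * U.card ≤ (edgesTouching G U).card + edgesWithin G (U : Set V) := by
  have hdeg : ∀ v, (G.incidenceFinset v).card = d := by
    intro v
    rw [SimpleGraph.card_incidenceFinset_eq_degree, ← hG v,
      ← SimpleGraph.card_neighborFinset_eq_degree, ← Set.ncard_coe_finset, SimpleGraph.coe_neighborFinset]
  have hwithin : edgesWithin G (U : Set V)
      = ((edgesTouching G U).filter fun e => ∀ v ∈ e, v ∈ U).card := by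
    rw [edgesWithin, ← Set.ncard_coe_finset]
    congr 1
    ext e
    induction e with | _ a b =>
    simp only [edgesTouching, Finset.coe_filter, Finset.mem_filter, SimpleGraph.mem_edgeFinset,
      Set.mem_ofPred_eq, Finset.mem_coe]
    constructor
    · exact fun h => ⟨⟨h.1, a, by simp, h.2 a (by simp)⟩, h.2⟩
    · exact fun h => ⟨h.1.1, h.2⟩
  have hpoint : ∀ e ∈ edgesTouching G U, (U.filter fun v => v ∈ e).card
      ≤ 1 + if ∀ v ∈ e, v ∈ U then 1 else 0 := by
    intro e _
    induction e with | _ a b =>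
    split_ifs with h
    · refine (Finset.card_le_card (t := {a, b}) ?_).trans Finset.card_le_two
      intro x hx
      simpa using (Finset.mem_filter.1 hx).2
    · rw [add_zero, Finset.card_le_one]
      intro x hx y hy
      simp only [Finset.mem_filter, Sym2.mem_iff] at hx hy
      by_contra hxy
      apply h
      intro z hz
      rw [Sym2.mem_iff] at hz
      grind
  calc d * U.card = ∑ v ∈ U, (G.incidenceFinset v).card := by simp [hdeg, mul_comm]
    _ = ∑ v ∈ U, ((edgesTouching G U).filter fun e => v ∈ e).card := by
        refine Finset.sum_congr rfl fun v hv => congrArg _ ?_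
        ext e
        simp only [SimpleGraph.mem_incidenceFinset, SimpleGraph.incidenceSet, Set.mem_sep_iff,
          edgesTouching, Finset.mem_filter, SimpleGraph.mem_edgeFinset]
        exact ⟨fun h => ⟨⟨h.1, v, h.2, hv⟩, h.2⟩, fun h => ⟨h.1.1, h.2⟩⟩
    _ = ∑ e ∈ edgesTouching G U, (U.filter fun v => v ∈ e).card :=
        Finset.sum_card_bipartiteAbove_eq_sum_card_bipartiteBelow fun v e => v ∈ e
    _ ≤ ∑ e ∈ edgesTouching G U, (1 + if ∀ v ∈ e, v ∈ U then 1 else 0) :=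
        Finset.sum_le_sum hpoint
    _ = _ := by rw [Finset.sum_add_distrib, hwithin, Finset.card_filter]; simp

/-- The probability of an event depending only on the edges of `F`. -/
lemma percProb_eq_sum_powerset {V : Type*} [Fintype V] {G : SimpleGraph V} (q : ℝ)
    {F : Finset (Sym2 V)} (hF : F ⊆ G.edgeFinset) {Q : Finset (Sym2 V) → Prop}
    (hQ : ∀ S ⊆ G.edgeFinset, (Q S ↔ Q (S ∩ F))) :
    percProb G q Q
      = ∑ A ∈ F.powerset, if Q A then q ^ A.card * (1 - q) ^ (F.card - A.card) else 0 := by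
  have hone : ∑ B ∈ (G.edgeFinset \ F).powerset,
      q ^ B.card * (1 - q) ^ ((G.edgeFinset \ F).card - B.card) = 1 := by
    rw [Finset.sum_pow_mul_eq_add_pow]; simp
  symm
  calc _ = ∑ A ∈ F.powerset, ∑ B ∈ (G.edgeFinset \ F).powerset,
        (if Q A then q ^ A.card * (1 - q) ^ (F.card - A.card) else 0) *
          (q ^ B.card * (1 - q) ^ ((G.edgeFinset \ F).card - B.card)) := by
        refine Finset.sum_congr rfl fun A _ => ?_
        rw [← Finset.mul_sum, hone, mul_one]
    _ = _ := by
        rw [← Finset.sum_product', percProb]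
        refine Finset.sum_bij' (fun x _ => x.1 ∪ x.2) (fun S _ => (S ∩ F, S \ F)) ?_ ?_ ?_ ?_ ?_
        · intro x hx
          simp only [Finset.mem_product, Finset.mem_powerset] at hx ⊢
          exact Finset.union_subset (hx.1.trans hF) (hx.2.trans Finset.sdiff_subset)
        · intro S hS
          simp only [Finset.mem_product, Finset.mem_powerset] at hS ⊢
          exact ⟨Finset.inter_subset_right, Finset.sdiff_subset_sdiff hS subset_rfl⟩
        · rintro ⟨A, B⟩ hx
          simp only [Finset.mem_product, Finset.mem_powerset] at hx
          ext e
          · have := @hx.1 e; have := @hx.2 e; simp at *; tauto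
          · have := @hx.1 e; have := @hx.2 e; simp at *; tauto
        · intro S _
          ext e; simp; tauto
        · rintro ⟨A, B⟩ hx
          simp only [Finset.mem_product, Finset.mem_powerset] at hx
          obtain ⟨hA, hB⟩ := hx
          have hdisj : Disjoint A B :=
            Finset.disjoint_of_subset_left hA
              (Finset.disjoint_of_subset_right hB Finset.disjoint_sdiff)
          have hAB : (A ∪ B) ∩ F = A := by
            ext e; have := @hA e; have := @hB e; simp at *; tauto
          have hiff := hQ (A ∪ B) (Finset.union_subset (hA.trans hF)
            (hB.trans Finset.sdiff_subset))
          rw [hAB] at hiff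
          have hcA := Finset.card_le_card hA
          have hcB := Finset.card_le_card hB
          have hcF := Finset.card_sdiff_add_card_eq_card hF
          simp only [hiff, percWeight, Finset.card_union_of_disjoint hdisj, ite_mul, zero_mul]
          congr 1
          rw [show G.edgeFinset.card - (A.card + B.card)
            = (F.card - A.card) + ((G.edgeFinset \ F).card - B.card) by omega, pow_add, pow_add]
          ring

lemma percWeight_nonneg {V : Type*} [Fintype V] (G : SimpleGraph V) {q : ℝ} (h0 : 0 ≤ q)
    (h1 : q ≤ 1) (S : Finset (Sym2 V)) : 0 ≤ percWeight G q S :=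
  mul_nonneg (pow_nonneg h0 _) (pow_nonneg (sub_nonneg.2 h1) _)

lemma sum_percWeight {V : Type*} [Fintype V] (G : SimpleGraph V) (q : ℝ) :
    ∑ S ∈ G.edgeFinset.powerset, percWeight G q S = 1 := by
  simp only [percWeight]
  rw [Finset.sum_pow_mul_eq_add_pow]; simp

/-- Decomposition of an event about the cluster of `v` according to the value of that cluster. -/
lemma percProb_cluster {V : Type*} [Fintype V] (G : SimpleGraph V) (q : ℝ) (v : V)
    (R : Finset V → Prop) :
    percProb G q (fun S => R (cluster S v))
      = ∑ U : Finset V, if R U then percProb G q (fun S => cluster S v = U) else 0 := by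
  have hswap : ∀ U : Finset V, (if R U then percProb G q (fun S => cluster S v = U) else 0)
      = ∑ S ∈ G.edgeFinset.powerset,
        if cluster S v = U then (if R U then percWeight G q S else 0) else 0 := by
    intro U
    rw [percProb]
    split_ifs
    · exact Finset.sum_congr rfl fun S _ => by congr
    · simp
  simp only [hswap]
  rw [Finset.sum_comm]
  simp [percProb]

/-- Comparison of the cluster probabilities at two retention probabilities with ratio `t > 1`. -/
lemma percProb_cluster_eq_le {V : Type*} [Fintype V] {G : SimpleGraph V} {d : ℕ}
    (hG : isRegular G d) {q t r c : ℝ} (hq0 : 0 ≤ q) (hq1 : q ≤ 1) (ht : 1 ≤ t) (hr0 : 0 < r)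
    (hr1 : r ≤ 1) (htr : 1 - t * q = r * (1 - q)) (v : V) (U : Finset V)
    (hU : (edgesWithin G (U : Set V) : ℝ) ≤ (1 + c) * U.card) :
    percProb G (t * q) (fun S => cluster S v = U)
      ≤ Real.exp (((1 + c) * Real.log t + (d - 2 - 2 * c) * Real.log r) * U.card)
        * percProb G q (fun S => cluster S v = U) := by
  have hF : edgesTouching G U ⊆ G.edgeFinset := Finset.filter_subset _ _
  rw [percProb_eq_sum_powerset _ hF fun S hS => cluster_eq_iff_inter hS v U,
    percProb_eq_sum_powerset _ hF fun S hS => cluster_eq_iff_inter hS v U, Finset.mul_sum]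
  refine Finset.sum_le_sum fun A hA => ?_
  rw [Finset.mem_powerset] at hA
  split_ifs with hAU
  swap
  · simp
  have hcard := card_le_edgesWithin hA hAU
  have hle := Finset.card_le_card hA
  have hdeg := mul_card_le_edgesTouching_add hG U
  set m := (edgesTouching G U).card - A.card
  have ht0 : 0 < t := one_pos.trans_le ht
  have h1 : (A.card : ℝ) ≤ (1 + c) * U.card := le_trans (by exact_mod_cast hcard) hU
  have h2 : (d - 2 - 2 * c) * U.card ≤ (m : ℝ) := by
    have : ((d * U.card : ℕ) : ℝ)
        ≤ (m + edgesWithin G (U : Set V) + edgesWithin G (U : Set V) : ℕ) := by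
      exact_mod_cast (by omega)
    push_cast at this
    linarith
  have h3 : t ^ A.card * r ^ m
      ≤ Real.exp (((1 + c) * Real.log t + (d - 2 - 2 * c) * Real.log r) * U.card) := by
    rw [← Real.exp_log (pow_pos ht0 A.card), ← Real.exp_log (pow_pos hr0 m), ← Real.exp_add,
      Real.log_pow, Real.log_pow, Real.exp_le_exp]
    have := mul_le_mul_of_nonneg_right h1 (Real.log_nonneg ht)
    have := mul_le_mul_of_nonpos_right h2 (Real.log_nonpos hr0.le hr1)
    linarith
  calc (t * q) ^ A.card * (1 - t * q) ^ m
      = (t ^ A.card * r ^ m) * (q ^ A.card * (1 - q) ^ m) := by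
        rw [htr, mul_pow, mul_pow]; ring
    _ ≤ _ := mul_le_mul_of_nonneg_right h3
        (mul_nonneg (pow_nonneg hq0 _) (pow_nonneg (sub_nonneg.2 hq1) _))

lemma percProb_le_one {V : Type*} [Fintype V] (G : SimpleGraph V) {q : ℝ} (h0 : 0 ≤ q)
    (h1 : q ≤ 1) (Q : Finset (Sym2 V) → Prop) : percProb G q Q ≤ 1 := by
  rw [← sum_percWeight G q]
  refine Finset.sum_le_sum fun S _ => ?_
  split_ifs
  · exact le_rfl
  · exact percWeight_nonneg G h0 h1 S

lemma percProb_nonneg {V : Type*} [Fintype V] (G : SimpleGraph V) {q : ℝ} (h0 : 0 ≤ q)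
    (h1 : q ≤ 1) (Q : Finset (Sym2 V) → Prop) : 0 ≤ percProb G q Q := by
  refine Finset.sum_nonneg fun S _ => ?_
  split_ifs
  · exact percWeight_nonneg G h0 h1 S
  · exact le_rfl

/-- The union bound, stated for the complementary event. -/
lemma one_sub_sum_le_percProb_forall {V ι : Type*} [Fintype V] [Fintype ι] (G : SimpleGraph V)
    {q : ℝ} (h0 : 0 ≤ q) (h1 : q ≤ 1) (B : ι → Finset (Sym2 V) → Prop) :
    1 - ∑ i, percProb G q (B i) ≤ percProb G q (fun S => ∀ i, ¬ B i S) := by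
  rw [sub_le_iff_le_add, ← sum_percWeight G q]
  simp only [percProb]
  rw [Finset.sum_comm, ← Finset.sum_add_distrib]
  refine Finset.sum_le_sum fun S _ => ?_
  have hw := percWeight_nonneg G h0 h1 S
  have hnn : ∀ i ∈ Finset.univ, 0 ≤ if B i S then percWeight G q S else 0 := by
    intro i _; split_ifs <;> simp [hw]
  by_cases h : ∀ i, ¬ B i S
  · rw [if_pos h]
    linarith [Finset.sum_nonneg hnn]
  · rw [if_neg h, zero_add]
    push Not at h
    obtain ⟨i, hi⟩ := h
    calc percWeight G q S = if B i S then percWeight G q S else 0 := by rw [if_pos hi]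
      _ ≤ _ := Finset.single_le_sum hnn (Finset.mem_univ i)

lemma sq_div_two_mul_le_sub_log {x : ℝ} (hx : 1 ≤ x) :
    (x - 1) ^ 2 / (2 * x) ≤ x - 1 - Real.log x := by
  have hx0 : 0 < x := one_pos.trans_le hx
  have h := Real.self_le_sinh_iff.2 (Real.log_nonneg hx)
  rw [Real.sinh_log hx0] at h
  have : (x - 1) ^ 2 / (2 * x) = x - 1 - (x - x⁻¹) / 2 := by field_simp; ring
  linarith

/-- Fix `d ≥ 3`, `1 < λ < d-1`, `p = λ/(d-1)`. There exist constants
`c > 0` and `C > 1` such that for every `ε > 0` there is `n₀`: for every `n ≥ n₀` and every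
`d`-regular graph `G` on `n` vertices satisfying (P2), with probability at least `1-ε` the
random subgraph `G_p` has no connected component whose order lies in
`[5λ log n/(λ-1)², log^C n]`. -/
theorem statement_10 (d : ℕ) (hd : 3 ≤ d) (lam : ℝ) (hlam₁ : 1 < lam)
    (hlam₂ : lam < (d : ℝ) - 1) (p : ℝ) (hp : p = lam / ((d : ℝ) - 1)) :
    ∃ c > (0 : ℝ), ∃ C > (1 : ℝ), ∀ ε > (0 : ℝ), ∃ n₀ : ℕ, ∀ n : ℕ, n₀ ≤ n →
    ∀ G : SimpleGraph (Fin n), isRegular G d →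
    (∀ U : Set (Fin n), (U.ncard : ℝ) ≤ Real.log n ^ C →
      (edgesWithin G U : ℝ) ≤ (1 + c) * U.ncard) →
    1 - ε ≤ percProb G p (fun S =>
      ∀ v : Fin n,
        ¬ (5 * lam * Real.log n / (lam - 1) ^ 2
              ≤ (compCard (SimpleGraph.fromEdgeSet (↑S : Set (Sym2 (Fin n)))) v : ℝ) ∧
           (compCard (SimpleGraph.fromEdgeSet (↑S : Set (Sym2 (Fin n)))) v : ℝ)
              ≤ Real.log n ^ C)) := by
  have hd1 : (0 : ℝ) < d - 1 := by linarith
  have hd2 : (0 : ℝ) < d - 2 := by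
    have : (3 : ℝ) ≤ d := by exact_mod_cast hd
    linarith
  have hlam0 : 0 < lam := one_pos.trans hlam₁
  set r : ℝ := (d - 1 - lam) / (d - 2) with hr
  have hr0 : 0 < r := div_pos (by linarith) hd2
  have hr1 : r ≤ 1 := by rw [hr, div_le_one hd2]; linarith
  set q : ℝ := 1 / (d - 1) with hq
  have hq0 : 0 ≤ q := by positivity
  have hq1 : q ≤ 1 := by rw [hq, div_le_one hd1]; linarith
  have hpq : p = lam * q := by rw [hp, hq]; ring
  have htr : 1 - lam * q = r * (1 - q) := by rw [hr, hq]; field_simp; ring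
  have hp0 : 0 ≤ p := by rw [hpq]; positivity
  have hp1 : p ≤ 1 := by rw [hp, div_le_one hd1]; linarith
  set L : ℝ := Real.log lam - 2 * Real.log r with hL
  have hL0 : 0 < L := by
    have := Real.log_pos hlam₁
    have := Real.log_nonpos hr0.le hr1
    linarith
  set η : ℝ := (lam - 1) ^ 2 / lam with hη
  have hη0 : 0 < η := div_pos (pow_pos (by linarith) 2) hlam0
  have hrate : (1 + η / (10 * L)) * Real.log lam
      + (d - 2 - 2 * (η / (10 * L))) * Real.log r ≤ -(2 / 5) * η := by
    have hlogr : (d - 2) * Real.log r ≤ -(lam - 1) := by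
      calc (d - 2) * Real.log r ≤ (d - 2) * (r - 1) :=
            mul_le_mul_of_nonneg_left (Real.log_le_sub_one_of_pos hr0) hd2.le
        _ = -(lam - 1) := by rw [hr]; field_simp; ring
    have hloglam := sq_div_two_mul_le_sub_log hlam₁.le
    have hhalf : (lam - 1) ^ 2 / (2 * lam) = η / 2 := by rw [hη]; field_simp
    have hcL : η / (10 * L) * L = η / 10 := by field_simp
    rw [hhalf] at hloglam
    have hexpand : (1 + η / (10 * L)) * Real.log lam
        + (d - 2 - 2 * (η / (10 * L))) * Real.log r
        = Real.log lam + (d - 2) * Real.log r + η / (10 * L) * L := by rw [hL]; ring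
    linarith
  refine ⟨η / (10 * L), by positivity, 2, one_lt_two, fun ε hε => ⟨max 1 ⌈1 / ε⌉₊, ?_⟩⟩
  intro n hn G hG hP2
  have hn1 : (0 : ℝ) < n := by exact_mod_cast (le_max_left _ _).trans hn
  have hnε : 1 / ε ≤ n := Nat.ceil_le.1 ((le_max_right _ _).trans hn)
  have hcluster : ∀ v : Fin n, percProb G p (fun S =>
      5 * lam * Real.log n / (lam - 1) ^ 2 ≤ ((cluster S v).card : ℝ) ∧
        ((cluster S v).card : ℝ) ≤ Real.log n ^ (2 : ℝ)) ≤ ((n : ℝ) ^ 2)⁻¹ := by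
    intro v
    rw [percProb_cluster G p v fun U => 5 * lam * Real.log n / (lam - 1) ^ 2 ≤ (U.card : ℝ) ∧
        (U.card : ℝ) ≤ Real.log n ^ (2 : ℝ)]
    have hsum : ∑ U : Finset (Fin n), percProb G q (fun S => cluster S v = U) ≤ 1 := by
      have := percProb_cluster G q v fun _ => True
      simp only [if_true] at this
      rw [← this]
      exact percProb_le_one G hq0 hq1 _
    calc _ ≤ ∑ U : Finset (Fin n),
          ((n : ℝ) ^ 2)⁻¹ * percProb G q (fun S => cluster S v = U) := by
          refine Finset.sum_le_sum fun U _ => ?_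
          have hnn := percProb_nonneg G hq0 hq1 fun S => cluster S v = U
          split_ifs with hU
          swap
          · positivity
          have hwithin := hP2 (U : Set (Fin n)) (by rw [Set.ncard_coe_finset]; exact hU.2)
          rw [Set.ncard_coe_finset] at hwithin
          rw [hpq]
          refine (percProb_cluster_eq_le hG hq0 hq1 hlam₁.le hr0 hr1 htr v U hwithin).trans
            (mul_le_mul_of_nonneg_right ?_ hnn)
          have hlog : 2 * Real.log n ≤ 2 / 5 * η * U.card := by
            have := mul_le_mul_of_nonneg_left hU.1 (by positivity : 0 ≤ 2 / 5 * η)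
            have hne : lam - 1 ≠ 0 := by linarith
            have heq : 2 / 5 * η * (5 * lam * Real.log n / (lam - 1) ^ 2) = 2 * Real.log n := by
              rw [hη]; field_simp
            linarith
          calc _ ≤ Real.exp (-(2 * Real.log n)) := by
                rw [Real.exp_le_exp]
                have := mul_le_mul_of_nonneg_right hrate (Nat.cast_nonneg' (α := ℝ) U.card)
                linarith
            _ = _ := by
                rw [Real.exp_neg, mul_comm, Real.exp_mul, Real.exp_log hn1, Real.rpow_two]
      _ = ((n : ℝ) ^ 2)⁻¹ * ∑ U : Finset (Fin n), percProb G q (fun S => cluster S v = U) := by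
          rw [Finset.mul_sum]
      _ ≤ _ := mul_le_of_le_one_right (by positivity) hsum
  simp only [compCard_eq_card_cluster]
  refine le_trans ?_ (one_sub_sum_le_percProb_forall G hp0 hp1 fun (v : Fin n) S =>
    5 * lam * Real.log n / (lam - 1) ^ 2 ≤ ((cluster S v).card : ℝ) ∧
      ((cluster S v).card : ℝ) ≤ Real.log n ^ (2 : ℝ))
  have hunion := Finset.sum_le_sum fun v (_ : v ∈ Finset.univ) => hcluster v
  have hcount : ∑ _v : Fin n, ((n : ℝ) ^ 2)⁻¹ = 1 / n := by
    simp only [Finset.sum_const, Finset.card_univ, Fintype.card_fin, nsmul_eq_mul]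
    field_simp
  have : 1 / (n : ℝ) ≤ ε := by
    rw [div_le_iff₀ hn1]
    rwa [div_le_iff₀ hε, mul_comm] at hnε
  linarith
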